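/- Let I be a nonempty finite index set; for each i ∈ I let T_i be a positive natural number, let S_lo,i, S_mid,i, S_hi,i partition {1,...,T_i}, let a_i ≥ 0 be a real number, and let h_i : {1,...,T_i} → [0,1]. Assume D := Σ_{i ∈ I} (1/T_i)·Σ_{t ∈ S_hi,i} h_i(t) > 0 and set λ* := (Σ_{i ∈ I} a_i · |S_lo,i|/T_i) / D. For signs s_i ∈ {+1,−1} define B_i(s_i) = (1/T_i)·(Σ_{t ∈ S_mid,i} a_i + Σ_{t ∈ S_hi,i} |s_i·a_i + λ*·h_i(t)|), and let E_i denote the average of B_i over s_i = +1 and s_i = −1. Then Σ_{i ∈ I} E_i ≤ Σ_{i ∈ I} a_i. -/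

import Mathlib

open Finset

/-- For nonnegative `x`, `y`, the average of `|x + y|` and `|-x + y|` is at most `x + y`. -/
theorem abs_add_add_abs_neg_add_le {x y : ℝ} (hx : 0 ≤ x) (hy : 0 ≤ y) :
    |x + y| + |-x + y| ≤ 2 * (x + y) := by
  have h₁ : |x + y| = x + y := abs_of_nonneg (add_nonneg hx hy)
  have h₂ : |-x + y| ≤ x + y := abs_le.2 ⟨by linarith, by linarith⟩
  linarith

/-- **Proposition 1 (per-batch budget balance, `κ = 1`).**
Under sign-symmetric averaging of the group-relative advantages, with the
batch-calibrated entropy-bonus coefficient `λ*`, the expected total EG-GRPO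
coefficient budget over the batch is at most the total GRPO budget `Σ_i a_i`. -/
theorem eg_grpo_per_batch_budget_balance (I : Type*) [Fintype I] [Nonempty I]
    (T : I → ℕ) (hT : ∀ i, 0 < T i)
    (Slo Smid Shi : (i : I) → Finset (Fin (T i)))
    (h_lo_mid : ∀ i, Disjoint (Slo i) (Smid i))
    (h_lo_hi : ∀ i, Disjoint (Slo i) (Shi i))
    (h_mid_hi : ∀ i, Disjoint (Smid i) (Shi i))
    (h_cover : ∀ i, Slo i ∪ Smid i ∪ Shi i = Finset.univ)
    (a : I → ℝ) (ha : ∀ i, 0 ≤ a i)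
    (h : (i : I) → Fin (T i) → ℝ) (hh : ∀ i t, h i t ∈ Set.Icc (0 : ℝ) 1)
    (D : ℝ) (hD : D = ∑ i, (1 / (T i : ℝ)) * ∑ t ∈ Shi i, h i t) (hDpos : 0 < D)
    (lamStar : ℝ)
    (hlam : lamStar = (∑ i, a i * ((Slo i).card : ℝ) / (T i : ℝ)) / D)
    (B : I → ℝ → ℝ)
    (hB : ∀ i, ∀ s : ℝ,
      B i s = (1 / (T i : ℝ)) *
        ((∑ _t ∈ Smid i, a i) + ∑ t ∈ Shi i, |s * a i + lamStar * h i t|))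
    (E : I → ℝ) (hE : ∀ i, E i = (1 / 2) * (B i 1 + B i (-1))) :
    ∑ i, E i ≤ ∑ i, a i := by
  have hlam_nonneg : 0 ≤ lamStar := by
    rw [hlam]
    exact div_nonneg (Finset.sum_nonneg fun i _ =>
      div_nonneg (mul_nonneg (ha i) (Nat.cast_nonneg _)) (Nat.cast_nonneg _)) hDpos.le
  have hcard (i : I) : ((Slo i).card : ℝ) + (Smid i).card + (Shi i).card = T i := by
    have hdisj : Disjoint (Slo i ∪ Smid i) (Shi i) :=
      Finset.disjoint_union_left.2 ⟨h_lo_hi i, h_mid_hi i⟩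
    have hc := congrArg Finset.card (h_cover i)
    rw [Finset.card_union_of_disjoint hdisj, Finset.card_union_of_disjoint (h_lo_mid i),
      Finset.card_univ, Fintype.card_fin] at hc
    exact_mod_cast hc
  have hE_le (i : I) : E i ≤ a i - a i * ((Slo i).card : ℝ) / (T i : ℝ) +
      lamStar * ((1 / (T i : ℝ)) * ∑ t ∈ Shi i, h i t) := by
    have hTi : (0 : ℝ) < T i := Nat.cast_pos.2 (hT i)
    have habs : ∑ t ∈ Shi i, |1 * a i + lamStar * h i t| +
        ∑ t ∈ Shi i, |-1 * a i + lamStar * h i t| ≤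
          2 * ((Shi i).card * a i + lamStar * ∑ t ∈ Shi i, h i t) := by
      calc
        _ = ∑ t ∈ Shi i, (|a i + lamStar * h i t| + |-a i + lamStar * h i t|) := by
          simp only [one_mul, neg_one_mul, Finset.sum_add_distrib]
        _ ≤ ∑ t ∈ Shi i, 2 * (a i + lamStar * h i t) :=
          Finset.sum_le_sum fun t _ =>
            abs_add_add_abs_neg_add_le (ha i) (mul_nonneg hlam_nonneg (hh i t).1)
        _ = _ := by
          rw [← Finset.mul_sum, Finset.sum_add_distrib, ← Finset.mul_sum, Finset.sum_const,
            nsmul_eq_mul]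
    calc
      E i = (1 / (T i : ℝ)) * ((Smid i).card * a i +
          (∑ t ∈ Shi i, |1 * a i + lamStar * h i t| +
            ∑ t ∈ Shi i, |-1 * a i + lamStar * h i t|) / 2) := by
        rw [hE, hB, hB, Finset.sum_const, nsmul_eq_mul]
        ring
      _ ≤ (1 / (T i : ℝ)) * ((Smid i).card * a i +
          ((Shi i).card * a i + lamStar * ∑ t ∈ Shi i, h i t)) := by
        gcongr
        linarith
      _ = _ := by
        have hmid : ((Smid i).card : ℝ) = T i - (Slo i).card - (Shi i).card := by
          linarith [hcard i]
        rw [hmid]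
        field_simp
        ring
  calc
    ∑ i, E i ≤ ∑ i, (a i - a i * ((Slo i).card : ℝ) / (T i : ℝ) +
        lamStar * ((1 / (T i : ℝ)) * ∑ t ∈ Shi i, h i t)) :=
      Finset.sum_le_sum fun i _ => hE_le i
    _ = ∑ i, a i - ∑ i, a i * ((Slo i).card : ℝ) / (T i : ℝ) + lamStar * D := by
      rw [Finset.sum_add_distrib, Finset.sum_sub_distrib, ← Finset.mul_sum, ← hD]
    _ = ∑ i, a i := by
      rw [hlam, div_mul_cancel₀ _ hDpos.ne', sub_add_cancel]
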